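/- The eta quotient \eta(8z)^8/\eta(4z)^4 is a holomorphic modular form of weight 2 for \Gamma_0(8) vanishing to order 2 at \infty, with q-expansion q^2 + 4q^6 + 6q^{10} + 8q^{14} + 13q^{18} + \cdots; in particular all exponents with nonzero coefficient are \equiv 2 mod 4. -/

import Mathlib

noncomputable section
open Complex UpperHalfPlane Matrix ModularForm CongruenceSubgroup Filter
open scoped ModularForm MatrixGroups Manifold Real

namespace Grid

/-- `e^{2πiz}`. -/
def qc (z : ℂ) : ℂ := Complex.exp (2 * ↑Real.pi * Complex.I * z)

/-- The quasimodular Eisenstein series `E₂(z) = 1 - 24 ∑ σ₁(n) qⁿ`. -/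
def E2 (z : ℂ) : ℂ :=
  1 - 24 * ∑' n : ℕ+, (ArithmeticFunction.sigma 1 n : ℂ) * qc z ^ (n : ℕ)

/-- The Dedekind eta function `η(z) = q^{1/24} ∏ (1 - qⁿ)`. -/
def eta (z : ℂ) : ℂ :=
  Complex.exp (↑Real.pi * Complex.I * z / 12) * ∏' n : ℕ+, (1 - qc z ^ (n : ℕ))

/-- `f` has a Fourier expansion at `∞` in powers of `q^{1/h}` with coefficients `a`. -/
def HasExpansion (h : ℕ+) (f : ℍ → ℂ) (a : ℤ → ℂ) : Prop :=
  ∀ z : ℍ, f z = ∑' n : ℤ, a n * Complex.exp (2 * ↑Real.pi * Complex.I * n * z / h)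

/-- The coefficients vanish below some bound. -/
def CoeffsBddBelow (a : ℤ → ℂ) : Prop := ∃ N : ℤ, ∀ n < N, a n = 0

/-- `f` is meromorphic at the cusp `α∞`. -/
def MeromAtCusp (k : ℤ) (f : ℍ → ℂ) (α : SL(2, ℤ)) : Prop :=
  ∃ (h : ℕ+) (a : ℤ → ℂ), CoeffsBddBelow a ∧ HasExpansion h (f ∣[k] α) a

/-- `f` is holomorphic at the cusp `α∞`. -/
def HoloAtCusp (k : ℤ) (f : ℍ → ℂ) (α : SL(2, ℤ)) : Prop :=
  ∃ (h : ℕ+) (a : ℤ → ℂ), (∀ n < 0, a n = 0) ∧ HasExpansion h (f ∣[k] α) a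

/-- `f` vanishes at the cusp `α∞`. -/
def VanishesAtCusp (k : ℤ) (f : ℍ → ℂ) (α : SL(2, ℤ)) : Prop :=
  ∃ (h : ℕ+) (a : ℤ → ℂ), (∀ n ≤ 0, a n = 0) ∧ HasExpansion h (f ∣[k] α) a

/-- `f` is a weakly holomorphic modular form of weight `k` for `Γ₀(N)`. -/
def IsWeaklyHol (N : ℕ) (k : ℤ) (f : ℍ → ℂ) : Prop :=
  MDifferentiable 𝓘(ℂ) 𝓘(ℂ) f ∧
  (∀ γ : Gamma0 N, f ∣[k] (γ : SL(2, ℤ)) = f) ∧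
  ∀ α : SL(2, ℤ), MeromAtCusp k f α

/-- The translation matrix `T = (1 1; 0 1)`. -/
def T : SL(2, ℤ) := ⟨!![1, 1; 0, 1], by norm_num [Matrix.det_fin_two_of]⟩

/-- `S = (0 -1; 1 0)`. -/
def S : SL(2, ℤ) := ⟨!![0, -1; 1, 0], by norm_num [Matrix.det_fin_two_of]⟩

/-- `Sj j = (0 -1; 1 j)`. -/
def Sj (j : ℤ) : SL(2, ℤ) := ⟨!![0, -1; 1, j], by norm_num [Matrix.det_fin_two_of]⟩

/-- `L c = (1 0; c 1)`. -/
def L (c : ℤ) : SL(2, ℤ) := ⟨!![1, 0; c, 1], by norm_num [Matrix.det_fin_two_of]⟩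

/-- `α` maps the cusp `∞` to a cusp `Γ₀(N)`-equivalent to `∞`. -/
def SendsInfToInf (N : ℕ) (α : SL(2, ℤ)) : Prop :=
  ∃ γ ∈ Gamma0 N, ∃ n : ℤ, α = γ * T ^ n

/-- `f` is a weakly holomorphic modular form of weight `k` for `Γ₀(N)` whose only possible
pole is at the cusp `∞`. -/
def PolesOnlyAtInf (N : ℕ) (k : ℤ) (f : ℍ → ℂ) : Prop :=
  IsWeaklyHol N k f ∧ ∀ α : SL(2, ℤ), ¬ SendsInfToInf N α → HoloAtCusp k f α

/-- `s` is a complete set of right coset representatives for `Γ₀(N)` in `Γ₀(M)`. -/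
def IsCosetReps (N M : ℕ) (s : Finset SL(2, ℤ)) : Prop :=
  (∀ γ ∈ s, γ ∈ Gamma0 M) ∧ ∀ δ ∈ Gamma0 M, ∃! γ, γ ∈ s ∧ δ * γ⁻¹ ∈ Gamma0 N

/-- An element of `GL(2, ℝ)⁺` from a matrix with positive determinant. -/
def glPos (M : Matrix (Fin 2) (Fin 2) ℝ) (h : 0 < M.det) : GL(2, ℝ)⁺ :=
  ⟨Matrix.GeneralLinearGroup.mkOfDetNeZero M (ne_of_gt h), by
    simpa [Matrix.mem_glpos, Matrix.GeneralLinearGroup.mkOfDetNeZero] using h⟩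

end Grid

open Grid

/-- The infinite product `∏ (1 - t^(n+1))`. -/
def PP (t : ℂ) : ℂ := ∏' n : ℕ, (1 - t ^ (n + 1))

lemma eta_eq (z : ℂ) : ModularForm.eta z =
    Complex.exp (2 * π * Complex.I * z / 24) * PP (Complex.exp (2 * π * Complex.I * z)) := by
  simp [ModularForm.eta, PP, ModularForm.eta_q, Function.Periodic.qParam]

lemma grid_eta_eq (z : ℂ) : Grid.eta z = ModularForm.eta z := by
  rw [eta_eq, Grid.eta, PP, tprod_pnat_eq_tprod_succ (f := fun n ↦ 1 - qc z ^ n)]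
  congr 2
  ring

lemma eta_add_one (z : ℂ) : ModularForm.eta (z + 1) =
    Complex.exp (2 * π * Complex.I / 24) * ModularForm.eta z := by
  rw [eta_eq, eta_eq, ← mul_assoc, ← Complex.exp_add]
  congr 2
  · ring
  · rw [mul_add, mul_one, Complex.exp_add, Complex.exp_two_pi_mul_I, mul_one]

/-- primitive cube root of unity -/
def om : ℂ := Complex.exp (2 * π * Complex.I / 24) ^ 8
def ze : ℂ := Complex.exp (2 * π * Complex.I / 24) ^ 4

lemma ze_sq : ze ^ 2 = om := by
  simp only [ze, om]; ring

lemma ze_cube : ze ^ 3 = -1 := by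
  rw [ze, ← pow_mul, ← Complex.exp_nat_mul, ← Complex.exp_pi_mul_I]
  congr 1
  push_cast
  ring

lemma ze_ne : ze ≠ 0 := by
  intro h
  have := ze_cube
  rw [h] at this
  norm_num at this

lemma eta4_T (z : ℂ) : ModularForm.eta (z + 1) ^ 4 = ze * ModularForm.eta z ^ 4 := by
  rw [eta_add_one, mul_pow]; rfl

lemma eta8_T (z : ℂ) : ModularForm.eta (z + 1) ^ 8 = ze ^ 2 * ModularForm.eta z ^ 8 := by
  rw [eta_add_one, mul_pow, ze_sq]; rfl

lemma sqrt_pow4 {z : ℂ} (hz : z ≠ 0) : Complex.sqrt z ^ 4 = z ^ 2 := by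
  rw [sqrt_eq_exp hz, ← exp_nat_mul]
  rw [show ((4 : ℕ) : ℂ) * (log z / 2) = (2 : ℕ) * log z by push_cast; ring, exp_nat_mul, exp_log hz]

lemma eta4_S {z : ℂ} (hz : 0 < z.im) :
    ModularForm.eta (-1 / z) ^ 4 = -z ^ 2 * ModularForm.eta z ^ 4 := by
  have h0 : z ≠ 0 := by rintro rfl; simp at hz
  have h := eta_comp_eq_csqrt_I_inv (x := z) hz
  simp only [Function.comp, Pi.smul_apply, Pi.mul_apply, smul_eq_mul] at h
  rw [h, mul_pow, mul_pow, inv_pow, sqrt_pow4 h0, sqrt_pow4 Complex.I_ne_zero]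
  simp

lemma eta8_S {z : ℂ} (hz : 0 < z.im) :
    ModularForm.eta (-1 / z) ^ 8 = z ^ 4 * ModularForm.eta z ^ 8 := by
  have h := eta4_S hz
  calc _ = (ModularForm.eta (-1 / z) ^ 4) ^ 2 := by ring
    _ = _ := by rw [h]; ring

/-- The three conjugate functions, indexed by bottom rows modulo 2. -/
def Phi (c d : ZMod 2) (z : ℍ) : ℂ :=
  if c = 0 then 16 * ModularForm.eta (2 * (z : ℂ)) ^ 8 / ModularForm.eta (z : ℂ) ^ 4
  else if d = 0 then ModularForm.eta ((z : ℂ) / 2) ^ 8 / ModularForm.eta (z : ℂ) ^ 4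
  else ze ^ 2 * ModularForm.eta (((z : ℂ) + 1) / 2) ^ 8 / ModularForm.eta (z : ℂ) ^ 4

lemma z01 (x : ZMod 2) : x = 0 ∨ x = 1 := by revert x; decide

lemma z11 : (1 + 1 : ZMod 2) = 0 := by decide

lemma Phi_T_aux (z : ℂ) :
    ModularForm.eta (2 * (z + 1)) ^ 8 = ze ^ 4 * ModularForm.eta (2 * z) ^ 8 := by
  rw [show 2 * (z + 1) = 2 * z + 1 + 1 by ring, eta8_T, eta8_T]; ring

lemma Phi_T (c d : ZMod 2) (hcd : c ≠ 0 ∨ d ≠ 0) :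
    Phi c d ∣[(2 : ℤ)] ModularGroup.T = -Phi c (c + d) := by
  ext z
  have hz : ((ModularGroup.T • z : ℍ) : ℂ) = z + 1 := by
    rw [UpperHalfPlane.modular_T_smul]; simp [add_comm]
  have hd : denom (ModularGroup.T : GL (Fin 2) ℝ) z = 1 := by
    rw [ModularGroup.denom_apply]; simp [ModularGroup.T]
  have he : ModularForm.eta (z : ℂ) ≠ 0 := eta_ne_zero z.2
  have h3 := ze_cube
  have h0 := ze_ne
  rw [SL_slash_apply, hd, _root_.one_zpow, mul_one]
  simp only [Phi, Pi.neg_apply, hz, eta4_T, Phi_T_aux]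
  rcases z01 c with rfl | rfl <;> rcases z01 d with rfl | rfl <;>
    simp [z11] at hcd ⊢
  · field_simp
    rw [h3]; ring
  · field_simp
    rw [h3]; ring
  · rw [show ((z : ℂ) + 1 + 1) / 2 = z / 2 + 1 by ring, eta8_T]
    field_simp
    rw [h3]; ring

lemma Phi_S_aux {w : ℂ} (hw : 0 < w.im) :
    ModularForm.eta ((w - 1) / (2 * w - 1)) ^ 8 = (2 * w - 1) ^ 4 * ModularForm.eta w ^ 8 := by
  have h1 : w - 1 ≠ 0 := fun h ↦ by simp [sub_eq_zero.mp h] at hw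
  have h2 : 2 * w - 1 ≠ 0 := fun h ↦ by
    have := congrArg Complex.im h
    simp at this; linarith
  have him : 0 < (-1 / (w - 1)).im := by
    have : (-1 / (w - 1)).im = w.im / Complex.normSq (w - 1) := by
      simp [neg_div]
    rw [this]
    exact div_pos hw (Complex.normSq_pos.mpr h1)
  have e1 : ModularForm.eta w ^ 8 = ze ^ 2 * ModularForm.eta (w - 1) ^ 8 := by
    rw [← eta8_T]; ring_nf
  have e2 : ModularForm.eta (-1 / (w - 1)) ^ 8 = (w - 1) ^ 4 * ModularForm.eta (w - 1) ^ 8 :=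
    eta8_S (by simpa using hw)
  set u : ℂ := -1 / (w - 1) - 2 with hu
  have e3 : ModularForm.eta (-1 / (w - 1)) ^ 8 = ze ^ 4 * ModularForm.eta u ^ 8 := by
    rw [show -1 / (w - 1) = u + 1 + 1 by rw [hu]; ring, eta8_T, eta8_T]; ring
  have hu0 : u = -(2 * w - 1) / (w - 1) := by rw [hu]; field_simp; ring
  have e4 : (w - 1) / (2 * w - 1) = -1 / u := by rw [hu0]; field_simp
  have him' : 0 < u.im := by rw [hu, Complex.sub_im]; simpa using him
  have h0 := ze_ne
  have h3 := ze_cube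
  have h6 : ze ^ 6 = 1 := by
    calc ze ^ 6 = (ze ^ 3) ^ 2 := by ring
      _ = 1 := by rw [h3]; norm_num
  have e5 : ModularForm.eta u ^ 8 = (w - 1) ^ 4 * ModularForm.eta w ^ 8 := by
    have : ze ^ 4 * ModularForm.eta u ^ 8 = (w - 1) ^ 4 * ModularForm.eta (w - 1) ^ 8 := by
      rw [← e3, e2]
    calc ModularForm.eta u ^ 8 = ze ^ 2 * (ze ^ 4 * ModularForm.eta u ^ 8) := by
          rw [← mul_assoc, ← pow_add, h6, one_mul]
      _ = _ := by rw [this, e1]; ring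
  rw [e4, eta8_S him', e5, hu0]
  field_simp

lemma Phi_S (c d : ZMod 2) (hcd : c ≠ 0 ∨ d ≠ 0) :
    Phi c d ∣[(2 : ℤ)] ModularGroup.S = -Phi d c := by
  ext z
  have hz : ((ModularGroup.S • z : ℍ) : ℂ) = -1 / z := by
    rw [UpperHalfPlane.modular_S_smul]; simp [neg_div]
  have hd : denom (ModularGroup.S : GL (Fin 2) ℝ) z = z := by
    exact ModularGroup.denom_S z
  have hz0 : (z : ℂ) ≠ 0 := z.ne_zero
  have him : 0 < (z : ℂ).im := z.2
  have he : ModularForm.eta (z : ℂ) ≠ 0 := eta_ne_zero z.2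
  rw [SL_slash_apply, hd]
  simp only [Phi, Pi.neg_apply, hz, eta4_S him]
  rw [_root_.zpow_neg, show ((z : ℂ) ^ (2 : ℤ)) = (z : ℂ) ^ 2 from zpow_ofNat _ 2]
  rcases z01 c with rfl | rfl <;> rcases z01 d with rfl | rfl <;>
    simp [z11] at hcd ⊢
  · rw [show 2 * (-1 / (z : ℂ)) = -1 / (z / 2) by field_simp,
      eta8_S (by simpa using him)]
    field_simp
    norm_num
  · rw [show -1 / (z : ℂ) / 2 = -1 / (2 * z) by field_simp,
      eta8_S (by simpa using him)]
    field_simp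
    norm_num
    ring
  · have : (-1 / (z : ℂ) + 1) / 2 =
        (((z : ℂ) + 1) / 2 - 1) / (2 * (((z : ℂ) + 1) / 2) - 1) := by
      rw [show 2 * (((z : ℂ) + 1) / 2) - 1 = z by ring]
      field_simp; ring
    rw [this, Phi_S_aux (by simpa using him), show 2 * (((z : ℂ) + 1) / 2) - 1 = z by ring]
    field_simp

/-- sign character on `SL₂(F₂)` -/
def sg (a b c d : ZMod 2) : ℂ :=
  if (a = 1 ∧ b = 0 ∧ c = 0 ∧ d = 1) ∨ a + d = 1 then 1 else -1

lemma sg_S (a b c d : ZMod 2) (h : a * d - b * c = 1) : sg b a d c = - sg a b c d := by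
  have : ∀ a b c d : ZMod 2, a * d - b * c = 1 →
    (((b = 1 ∧ a = 0 ∧ d = 0 ∧ c = 1) ∨ b + c = 1) ↔
      ¬ ((a = 1 ∧ b = 0 ∧ c = 0 ∧ d = 1) ∨ a + d = 1)) := by decide
  simp only [sg, this a b c d h]
  split_ifs <;> simp_all

lemma sg_T (a b c d : ZMod 2) (h : a * d - b * c = 1) :
    sg a (a + b) c (c + d) = - sg a b c d := by
  have : ∀ a b c d : ZMod 2, a * d - b * c = 1 →
    (((a = 1 ∧ a + b = 0 ∧ c = 0 ∧ c + d = 1) ∨ a + (c + d) = 1) ↔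
      ¬ ((a = 1 ∧ b = 0 ∧ c = 0 ∧ d = 1) ∨ a + d = 1)) := by decide
  simp only [sg, this a b c d h]
  split_ifs <;> simp_all

lemma slash_inv_of {f g : ℍ → ℂ} {γ : SL(2, ℤ)} (h : g ∣[(2 : ℤ)] γ = -f) :
    f ∣[(2 : ℤ)] γ⁻¹ = -g := by
  have : f = -(g ∣[(2 : ℤ)] γ) := by rw [h]; simp
  rw [this, SlashAction.neg_slash, ← SlashAction.slash_mul]
  simp

lemma det2 (γ : SL(2, ℤ)) : ((γ 0 0 : ℤ) : ZMod 2) * (γ 1 1 : ℤ) - (γ 0 1 : ℤ) * (γ 1 0 : ℤ) = 1 := by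
  have := Matrix.SpecialLinearGroup.det_coe γ
  rw [Matrix.det_fin_two] at this
  exact_mod_cast congrArg (Int.cast : ℤ → ZMod 2) this

lemma row2 (γ : SL(2, ℤ)) : ((γ 1 0 : ℤ) : ZMod 2) ≠ 0 ∨ ((γ 1 1 : ℤ) : ZMod 2) ≠ 0 := by
  by_contra! h
  have := det2 γ
  rw [h.1, h.2] at this
  simp at this

lemma zz (x : ZMod 2) : -x = x := by revert x; decide

lemma mul_S_entries (x : SL(2, ℤ)) : (x * ModularGroup.S) 0 0 = x 0 1 ∧
    (x * ModularGroup.S) 0 1 = -x 0 0 ∧ (x * ModularGroup.S) 1 0 = x 1 1 ∧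
    (x * ModularGroup.S) 1 1 = -x 1 0 := by
  refine ⟨?_, ?_, ?_, ?_⟩
  · change (x.1 * ModularGroup.S.1) 0 0 = _; simp [Matrix.mul_apply, ModularGroup.S]
  · change (x.1 * ModularGroup.S.1) 0 1 = _; simp [Matrix.mul_apply, ModularGroup.S]
  · change (x.1 * ModularGroup.S.1) 1 0 = _; simp [Matrix.mul_apply, ModularGroup.S]
  · change (x.1 * ModularGroup.S.1) 1 1 = _; simp [Matrix.mul_apply, ModularGroup.S]

lemma mul_T_entries (x : SL(2, ℤ)) : (x * ModularGroup.T) 0 0 = x 0 0 ∧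
    (x * ModularGroup.T) 0 1 = x 0 0 + x 0 1 ∧ (x * ModularGroup.T) 1 0 = x 1 0 ∧
    (x * ModularGroup.T) 1 1 = x 1 0 + x 1 1 := by
  refine ⟨?_, ?_, ?_, ?_⟩
  · change (x.1 * ModularGroup.T.1) 0 0 = _; simp [Matrix.mul_apply, ModularGroup.T]
  · change (x.1 * ModularGroup.T.1) 0 1 = _; simp [Matrix.mul_apply, ModularGroup.T]
  · change (x.1 * ModularGroup.T.1) 1 0 = _; simp [Matrix.mul_apply, ModularGroup.T]
  · change (x.1 * ModularGroup.T.1) 1 1 = _; simp [Matrix.mul_apply, ModularGroup.T]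

lemma X_slash (γ : SL(2, ℤ)) : Phi 0 1 ∣[(2 : ℤ)] γ =
    sg (γ 0 0 : ℤ) (γ 0 1 : ℤ) (γ 1 0 : ℤ) (γ 1 1 : ℤ) • Phi (γ 1 0 : ℤ) (γ 1 1 : ℤ) := by
  have : γ ∈ Subgroup.closure {ModularGroup.S, ModularGroup.T} := by
    simp [SpecialLinearGroup.SL2Z_generators]
  induction this using Subgroup.closure_induction_right with
  | one => simp [sg]
  | mul_right x hx y hy ih =>
    rw [SlashAction.slash_mul, ih, SL_smul_slash]
    have hx2 := row2 x
    have hdt := det2 x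
    rcases hy with rfl | rfl
    · rw [Phi_S _ _ hx2]
      obtain ⟨e1, e2, e3, e4⟩ := mul_S_entries x
      rw [e1, e2, e3, e4]
      push_cast
      simp [zz, sg_S _ _ _ _ hdt]
    · rw [Phi_T _ _ hx2]
      obtain ⟨e1, e2, e3, e4⟩ := mul_T_entries x
      rw [e1, e2, e3, e4]
      push_cast
      simp [sg_T _ _ _ _ hdt]
  | mul_inv_cancel x hx y hy ih =>
    rw [SlashAction.slash_mul, ih, SL_smul_slash]
    rcases hy with rfl | rfl
    · obtain ⟨w, rfl⟩ : ∃ w, x = w * ModularGroup.S := ⟨x * ModularGroup.S⁻¹, by group⟩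
      rw [mul_inv_cancel_right]
      have hw2 := row2 w
      have hdt := det2 w
      obtain ⟨e1, e2, e3, e4⟩ := mul_S_entries w
      rw [e1, e2, e3, e4]
      push_cast
      rw [zz, zz, slash_inv_of (Phi_S _ _ hw2), sg_S _ _ _ _ hdt]
      simp
    · obtain ⟨w, rfl⟩ : ∃ w, x = w * ModularGroup.T := ⟨x * ModularGroup.T⁻¹, by group⟩
      rw [mul_inv_cancel_right]
      have hw2 := row2 w
      have hdt := det2 w
      obtain ⟨e1, e2, e3, e4⟩ := mul_T_entries w
      rw [e1, e2, e3, e4]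
      push_cast
      rw [slash_inv_of (Phi_T _ _ hw2), sg_T _ _ _ _ hdt]
      simp

lemma PP_diff : DifferentiableOn ℂ PP (Metric.ball 0 1) :=
  ModularForm.differentiableOn_tprod_one_sub_pow

lemma PP_zero : PP 0 = 1 := by simp [PP]

lemma PP_cont : ContinuousAt PP 0 :=
  (PP_diff.differentiableAt (Metric.ball_mem_nhds _ one_pos)).continuousAt

lemma PP_ne {t : ℂ} (ht : ‖t‖ < 1) : PP t ≠ 0 := by
  simp only [PP, sub_eq_add_neg]
  refine tprod_one_add_ne_zero_of_summable (f := fun n : ℕ ↦ -t ^ (n + 1)) ?_ ?_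
  · intro i h
    have h1 : t ^ (i + 1) = 1 := by
      linear_combination -h
    have h2 : ‖t‖ ^ (i + 1) = 1 := by rw [← norm_pow, h1, norm_one]
    have h3 : ‖t‖ ^ (i + 1) < 1 := pow_lt_one₀ (norm_nonneg _) ht (by omega)
    linarith
  · simp only [norm_neg, norm_pow]
    exact (summable_nat_add_iff 1).mpr (summable_geometric_of_lt_one (norm_nonneg _) ht)

/-- `z ↦ exp (2πi z/h)` tends to zero. -/
lemma q_tendsto (h : ℝ) (hh : 0 < h) :
    Tendsto (fun z : ℍ ↦ Complex.exp (2 * π * Complex.I * z / h)) atImInfty (nhds 0) :=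
  UpperHalfPlane.qParam_tendsto_atImInfty hh

lemma PP_tendsto {f : ℍ → ℂ} (hf : Tendsto f atImInfty (nhds 0)) :
    Tendsto (fun z ↦ PP (f z)) atImInfty (nhds 1) := by
  have := PP_cont.tendsto.comp hf
  rwa [PP_zero] at this

lemma Phi_form (f : ℂ → ℂ) (z : ℂ) : ModularForm.eta (f z) ^ 8 / ModularForm.eta z ^ 4 =
    Complex.exp (2 * π * Complex.I * (2 * f z - z) / 6) *
      PP (Complex.exp (2 * π * Complex.I * f z)) ^ 8 /
      PP (Complex.exp (2 * π * Complex.I * z)) ^ 4 := by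
  rw [eta_eq, eta_eq, mul_pow, mul_pow, ← Complex.exp_nat_mul, ← Complex.exp_nat_mul,
    mul_div_mul_comm, ← Complex.exp_sub, ← mul_div_assoc]
  congr 3
  push_cast
  ring

lemma Phi_bdd (c d : ZMod 2) : IsBoundedAtImInfty (Phi c d) := by
  have q1 := PP_tendsto (q_tendsto 1 one_pos)
  have q2 := q_tendsto 2 two_pos
  have qh := q_tendsto (1 / 2) (by norm_num)
  simp only [ofReal_one, div_one] at q1
  have key : ∃ l, Tendsto (Phi c d) atImInfty (nhds l) := by
    rcases z01 c with rfl | rfl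
    · refine ⟨_, (((q2.const_mul 16).mul ((PP_tendsto qh).pow 8)).div (q1.pow 4)
        (by norm_num)).congr fun z ↦ ?_⟩
      simp only [Phi, if_true, mul_div_assoc]
      rw [Phi_form (fun z ↦ 2 * z)]
      simp only [Pi.div_apply]
      rw [show 2 * π * Complex.I * (2 * (2 * (z : ℂ)) - z) / 6 =
          2 * π * Complex.I * z / (2 : ℝ) by push_cast; ring,
        show 2 * π * Complex.I * (2 * (z : ℂ)) = 2 * π * Complex.I * z / (1 / 2 : ℝ) by
          push_cast; ring]
      ring
    · rcases z01 d with rfl | rfl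
      · refine ⟨_, (((PP_tendsto q2).pow 8).div (q1.pow 4)
          (by norm_num)).congr fun z ↦ ?_⟩
        simp only [Phi, if_true, mul_div_assoc, one_ne_zero, if_false]
        rw [Phi_form (fun z ↦ z / 2)]
        simp only [Pi.div_apply]
        congr 2
        rw [show 2 * π * Complex.I * (2 * ((z : ℂ) / 2) - z) / 6 = 0 by ring]
        simp [mul_div_assoc]
      · have q3 : Tendsto (fun z : ℍ ↦ Complex.exp (2 * π * Complex.I * z / (2 : ℝ)) *
            Complex.exp (2 * π * Complex.I / 2)) atImInfty (nhds 0) := by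
          simpa using q2.mul_const (Complex.exp (2 * π * Complex.I / 2))
        refine ⟨_, ((((PP_tendsto q3).pow 8).div (q1.pow 4)
          (by norm_num)).const_mul (ze ^ 2 * Complex.exp (2 * π * Complex.I / 6))).congr
            fun z ↦ ?_⟩
        simp only [Phi, mul_div_assoc, one_ne_zero, if_false]
        rw [Phi_form (fun z ↦ (z + 1) / 2)]
        simp only [Pi.div_apply]
        rw [← Complex.exp_add,
          show 2 * π * Complex.I * (2 * (((z : ℂ) + 1) / 2) - z) / 6 =
            2 * π * (Complex.I / 6) by ring,
          show 2 * π * Complex.I * (((z : ℂ) + 1) / 2) =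
            2 * π * (Complex.I * (z / (2 : ℝ))) + 2 * π * (Complex.I / 2) by push_cast; ring]
        ring
  obtain ⟨l, hl⟩ := key
  exact hl.isBigO_one ℝ

/-- `diag(4,1)`. -/
def g4 : GL (Fin 2) ℚ := Matrix.GeneralLinearGroup.mkOfDetNeZero !![4, 0; 0, 1] (by simp)
def G4 : GL (Fin 2) ℝ := g4.map (Rat.castHom ℝ)

lemma G4_val : (G4 : Matrix (Fin 2) (Fin 2) ℝ) = !![4, 0; 0, 1] := by
  ext i j
  fin_cases i <;> fin_cases j <;> simp [G4, g4, Matrix.GeneralLinearGroup.mkOfDetNeZero]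

def FF (z : ℍ) : ℂ := Grid.eta (8 * (z : ℂ)) ^ 8 / Grid.eta (4 * (z : ℂ)) ^ 4

lemma G4_det : (G4.det.val : ℝ) = 4 := by
  simp [Matrix.GeneralLinearGroup.val_det_apply, G4_val]

lemma FF_eq : FF = (1 / 64 : ℂ) • (Phi 0 1 ∣[(2 : ℤ)] G4) := by
  ext z
  have hdet := G4_det
  have hs : ((G4 • z : ℍ) : ℂ) = 4 * z := by
    rw [UpperHalfPlane.coe_smul_of_det_pos (by rw [hdet]; norm_num)]
    simp [num, denom, G4_val]
  have hd : denom G4 z = 1 := by simp [denom, G4_val]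
  simp only [Pi.smul_apply, ModularForm.slash_apply, hd, hdet, FF, Phi, hs, grid_eta_eq, smul_eq_mul]
  have hσ : ∀ w, UpperHalfPlane.σ G4 w = w := fun w ↦ by
    rw [UpperHalfPlane.σ, if_pos (by rw [hdet]; norm_num)]; rfl
  rw [hσ]
  simp
  ring_nf

lemma FF_slash (γ : SL(2, ℤ)) (hγ : γ ∈ Gamma0 8) : FF ∣[(2 : ℤ)] γ = FF := by
  rw [Gamma0_mem, ZMod.intCast_zmod_eq_zero_iff_dvd] at hγ
  obtain ⟨c, hc⟩ := hγ
  have hdet := Matrix.SpecialLinearGroup.det_coe γ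
  rw [Matrix.det_fin_two] at hdet
  push_cast at hc
  let γ' : SL(2, ℤ) := ⟨!![γ 0 0, 4 * γ 0 1; 2 * c, γ 1 1], by
    rw [hc] at hdet; rw [Matrix.det_fin_two_of]; linear_combination hdet⟩
  have hcomm : G4 * (Matrix.SpecialLinearGroup.mapGL ℝ γ) =
      (Matrix.SpecialLinearGroup.mapGL ℝ γ') * G4 := by
    have e1 : γ' 0 0 = γ 0 0 := rfl
    have e2 : γ' 0 1 = 4 * γ 0 1 := rfl
    have e3 : γ' 1 0 = 2 * c := rfl
    have e4 : γ' 1 1 = γ 1 1 := rfl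
    ext i j
    simp only [Matrix.GeneralLinearGroup.coe_mul, G4_val]
    clear_value γ'
    fin_cases i <;> fin_cases j <;> simp [Matrix.mul_apply, e1, e2, e3, e4, hc] <;> ring
  have hX : Phi 0 1 ∣[(2 : ℤ)] γ' = Phi 0 1 := by
    have h2 : (2 : ZMod 2) = 0 := by decide
    have h4 : (4 : ZMod 2) = 0 := by decide
    have hd2 := det2 γ'
    have e := X_slash γ'
    have e1 : γ' 0 0 = γ 0 0 := rfl
    have e2 : γ' 0 1 = 4 * γ 0 1 := rfl
    have e3 : γ' 1 0 = 2 * c := rfl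
    have e4 : γ' 1 1 = γ 1 1 := rfl
    rw [e1, e2, e3, e4] at e hd2
    push_cast at e hd2
    rw [h2, h4, zero_mul, zero_mul] at e
    rw [h2, h4, zero_mul, zero_mul, sub_zero] at hd2
    rw [e]
    rcases z01 ((γ 0 0 : ℤ) : ZMod 2) with h | h <;> rcases z01 ((γ 1 1 : ℤ) : ZMod 2) with h' | h' <;>
      rw [h, h'] at hd2 ⊢ <;> simp [sg] at hd2 ⊢
  have hX' : Phi 0 1 ∣[(2 : ℤ)] (Matrix.SpecialLinearGroup.mapGL ℝ γ') = Phi 0 1 := hX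
  rw [FF_eq, SL_smul_slash]
  congr 1
  change (Phi 0 1 ∣[(2 : ℤ)] G4) ∣[(2 : ℤ)] (Matrix.SpecialLinearGroup.mapGL ℝ γ) = _
  rw [← SlashAction.slash_mul, hcomm, SlashAction.slash_mul, hX']

lemma FF_bdd {c : OnePoint ℝ} (hc : IsCusp c 𝒮ℒ) : OnePoint.IsBoundedAt c FF 2 := by
  have h1 : OnePoint.IsBoundedAt c (Phi 0 1 ∣[(2 : ℤ)] G4) 2 := by
    rw [← OnePoint.IsBoundedAt.smul_iff]
    have hc' : IsCusp (G4 • c) 𝒮ℒ := by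
      rw [isCusp_SL2Z_iff] at hc ⊢
      obtain ⟨x, rfl⟩ := hc
      refine ⟨g4 • x, ?_⟩
      rw [← Rat.coe_castHom, OnePoint.map_smul]
      rfl
    rw [OnePoint.isBoundedAt_iff_forall_SL2Z hc']
    intro γ _
    rw [X_slash]
    exact (Phi_bdd _ _).const_mul_left _
  intro g hg
  have := h1 g hg
  rw [FF_eq, ModularForm.smul_slash]
  exact this.const_mul_left _

lemma FF_holo : MDifferentiable 𝓘(ℂ) 𝓘(ℂ) FF := by
  rw [UpperHalfPlane.mdifferentiable_iff]
  have : DifferentiableOn ℂ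
      (fun z : ℂ ↦ ModularForm.eta (8 * z) ^ 8 / ModularForm.eta (4 * z) ^ 4)
      {z | 0 < z.im} := by
    intro z hz
    have h8 : 0 < (8 * z).im := by simpa using hz
    have h4 : 0 < (4 * z).im := by simpa using hz
    have d8 := (differentiableAt_eta_of_mem_upperHalfPlaneSet h8).comp z
      (differentiableAt_id.const_mul (8 : ℂ))
    have d4 := (differentiableAt_eta_of_mem_upperHalfPlaneSet h4).comp z
      (differentiableAt_id.const_mul (4 : ℂ))
    exact ((d8.pow 8).div (d4.pow 4) (pow_ne_zero _ (eta_ne_zero h4))).differentiableWithinAt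
  refine this.congr fun z hz ↦ ?_
  simp [FF, grid_eta_eq, ofComplex_apply_of_im_pos hz]

def FM : ModularForm (Gamma0 8) 2 where
  toFun := FF
  slash_action_eq' := by
    rintro _ ⟨γ, hγ, rfl⟩
    exact FF_slash γ hγ
  holo' := FF_holo
  bdd_at_cusps' hc := by
    rw [Subgroup.IsArithmetic.isCusp_iff_isCusp_SL2Z] at hc
    exact FF_bdd hc

open Asymptotics in
lemma tail_isBigO (m : ℕ) :
    (fun t : ℂ ↦ ∏' n : ℕ, (1 - t ^ (n + m + 1)) - 1) =O[nhds 0] fun t ↦ t ^ (m + 1) := by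
  refine IsBigO.of_bound 4 ?_
  filter_upwards [Metric.ball_mem_nhds (0 : ℂ) (show (0 : ℝ) < 1 / 2 by norm_num)] with t ht
  have ht : ‖t‖ < 1 / 2 := by simpa using ht
  have hs : Summable fun n : ℕ ↦ ‖-t ^ (n + m + 1)‖ := by
    simp only [norm_neg, norm_pow, add_assoc]
    exact (summable_nat_add_iff (m + 1)).mpr
      (summable_geometric_of_lt_one (norm_nonneg _) (by linarith))
  have hsum : ∑' n : ℕ, ‖-t ^ (n + m + 1)‖ ≤ 2 * ‖t‖ ^ (m + 1) := by
    simp only [norm_neg, norm_pow, add_assoc, pow_add ‖t‖ _ (m + 1)]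
    rw [tsum_mul_right, tsum_geometric_of_lt_one (norm_nonneg _) (by linarith)]
    gcongr
    rw [inv_le_comm₀ (by linarith) two_pos]
    linarith
  have hm : Multipliable fun n : ℕ ↦ 1 + (-t ^ (n + m + 1)) :=
    multipliable_one_add_of_summable hs
  have hle : ‖∏' n : ℕ, (1 + (-t ^ (n + m + 1))) - 1‖ ≤
      Real.exp (∑' n : ℕ, ‖-t ^ (n + m + 1)‖) - 1 := by
    refine le_of_tendsto ((hm.hasProd.sub_const 1).norm) (Eventually.of_forall fun s ↦ ?_)
    refine (s.norm_prod_one_add_sub_one_le _).trans ?_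
    gcongr
    exact hs.sum_le_tsum _ (fun _ _ ↦ norm_nonneg _)
  simp only [← sub_eq_add_neg] at hle
  refine hle.trans ?_
  have h0 : ‖t‖ ^ (m + 1) ≤ 1 / 2 := by
    calc ‖t‖ ^ (m + 1) ≤ ‖t‖ ^ 1 := pow_le_pow_of_le_one (norm_nonneg _) (by linarith) (by omega)
      _ ≤ _ := by rw [pow_one]; exact ht.le
  have hx : 0 ≤ 2 * ‖t‖ ^ (m + 1) := by positivity
  have := Real.abs_exp_sub_one_le (x := 2 * ‖t‖ ^ (m + 1)) (by rw [abs_of_nonneg hx]; linarith)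
  rw [abs_of_nonneg hx] at this
  rw [norm_pow]
  have h5 := Real.exp_le_exp.mpr hsum
  have h6 := (abs_le.mp this).2
  linarith

lemma PP_split {t : ℂ} (ht : ‖t‖ < 1) (m : ℕ) :
    PP t = (∏ i ∈ Finset.range m, (1 - t ^ (i + 1))) * ∏' n : ℕ, (1 - t ^ (n + m + 1)) := by
  have hs : Summable fun n : ℕ ↦ ‖-t ^ (n + 1)‖ := by
    simp only [norm_neg, norm_pow]
    exact (summable_nat_add_iff 1).mpr
      (summable_geometric_of_lt_one (norm_nonneg _) (by linarith))
  have hm : Multipliable fun n : ℕ ↦ 1 - t ^ (n + 1) := by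
    simpa only [← sub_eq_add_neg] using multipliable_one_add_of_summable hs
  have hs' : Summable fun n : ℕ ↦ ‖-t ^ (n + m + 1)‖ := by
    simp only [norm_neg, norm_pow, add_assoc]
    exact (summable_nat_add_iff (m + 1)).mpr
      (summable_geometric_of_lt_one (norm_nonneg _) (by linarith))
  have hm' : Multipliable fun n : ℕ ↦ 1 - t ^ (n + m + 1) := by
    simpa only [← sub_eq_add_neg] using multipliable_one_add_of_summable hs'
  have := hm'.hasProd.tendsto_prod_nat
  have h1 := (this.const_mul (∏ i ∈ Finset.range m, (1 - t ^ (i + 1))))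
  have h2 := (tendsto_add_atTop_iff_nat m).mpr hm.hasProd.tendsto_prod_nat
  refine tendsto_nhds_unique h2 (h1.congr fun n ↦ ?_)
  rw [add_comm n m, Finset.prod_range_add]
  simp only [add_comm m]

/-- congruence modulo `t^5` near zero -/
def Cong (f g : ℂ → ℂ) : Prop := (fun t ↦ f t - g t) =O[nhds 0] fun t : ℂ ↦ t ^ 5

lemma Cong.trans {f g h : ℂ → ℂ} (h1 : Cong f g) (h2 : Cong g h) : Cong f h := by
  have := Asymptotics.IsBigO.add h1 h2
  simpa [Cong] using this

lemma Cong.symm {f g : ℂ → ℂ} (h1 : Cong f g) : Cong g f := by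
  have := Asymptotics.IsBigO.neg_left h1
  simpa [Cong] using this

lemma Cong.mul {f g f' g' : ℂ → ℂ} (h : Cong f g) (h' : Cong f' g')
    (hf : ContinuousAt f' 0) (hg : ContinuousAt g 0) :
    Cong (fun t ↦ f t * f' t) (fun t ↦ g t * g' t) := by
  have h1 := Asymptotics.IsBigO.mul h (hf.tendsto.isBigO_one ℂ)
  have h2 := Asymptotics.IsBigO.mul (hg.tendsto.isBigO_one ℂ) h'
  simp only [mul_one, one_mul] at h1 h2
  refine (h1.add h2).congr_left fun t ↦ ?_
  ring

lemma Cong.of_eq_mul {f g k : ℂ → ℂ} (h : ∀ t, f t = g t + t ^ 5 * k t) (hk : ContinuousAt k 0) :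
    Cong f g := by
  have := (Asymptotics.isBigO_refl (fun t : ℂ ↦ t ^ 5) (nhds 0)).mul (hk.tendsto.isBigO_one ℂ)
  simp only [mul_one] at this
  exact this.congr_left fun t ↦ by rw [h]; ring

lemma PP_cong : Cong PP (fun t ↦ 1 - t - t ^ 2) := by
  have h : Cong PP (fun t ↦ (∏ i ∈ Finset.range 4, (1 - t ^ (i + 1)))) := by
    have h1 := (tail_isBigO 4)
    have hc : ContinuousAt (fun t : ℂ ↦ ∏ i ∈ Finset.range 4, (1 - t ^ (i + 1))) 0 := by fun_prop
    have h2 := Asymptotics.IsBigO.mul (hc.tendsto.isBigO_one ℂ) h1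
    simp only [one_mul] at h2
    refine h2.congr' ?_ .rfl
    filter_upwards [Metric.ball_mem_nhds (0 : ℂ) one_pos] with t ht
    rw [PP_split (by simpa using ht) 4]
    ring
  refine h.trans (Cong.of_eq_mul (k := fun t ↦ 2 - t ^ 3 - t ^ 4 + t ^ 5) (fun t ↦ ?_) (by fun_prop))
  simp only [Finset.prod_range_succ, Finset.prod_range_zero]
  ring

lemma poly_cong : Cong (fun t ↦ (1 - t ^ 2 - t ^ 4) ^ 8)
    (fun t ↦ (1 + 4 * t + 6 * t ^ 2 + 8 * t ^ 3 + 13 * t ^ 4) * (1 - t - t ^ 2) ^ 4) := by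
  refine Cong.of_eq_mul (k := fun t ↦ (16) * t ^ 0 + (-30) * t ^ 1 + (-28) * t ^ 2 + (30) * t ^ 3 + (60) * t ^ 4 + (-8) * t ^ 5 + (-60) * t ^ 6 + (99) * t ^ 7
    + (-120) * t ^ 9 + (-125) * t ^ 11 + (120) * t ^ 13 + (112) * t ^ 15 + (-56) * t ^ 17 + (-70) * t ^ 19 + (20) * t ^ 23
    + (8) * t ^ 25 + (1) * t ^ 27) (fun t ↦ ?_) (by fun_prop)
  ring

lemma Cong.refl (f : ℂ → ℂ) : Cong f f := by
  simp [Cong, Asymptotics.isBigO_zero]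

lemma Cong.pow {f g : ℂ → ℂ} (h : Cong f g) (hf : ContinuousAt f 0) (hg : ContinuousAt g 0)
    (n : ℕ) : Cong (fun t ↦ f t ^ n) (fun t ↦ g t ^ n) := by
  induction n with
  | zero => simpa using Cong.refl _
  | succ n ih =>
    simp only [pow_succ]
    exact ih.mul h hf (hg.pow n)

lemma sq_tendsto : Tendsto (fun t : ℂ ↦ t ^ 2) (nhds 0) (nhds 0) := by
  have : Continuous (fun t : ℂ ↦ t ^ 2) := by fun_prop
  simpa using this.tendsto 0

lemma PP2_cont : ContinuousAt (fun t ↦ PP (t ^ 2)) 0 := by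
  have := PP_cont.tendsto.comp sq_tendsto
  simpa [ContinuousAt, Function.comp_def] using this

lemma PP2_cong : Cong (fun t ↦ PP (t ^ 2)) (fun t ↦ 1 - t ^ 2 - t ^ 4) := by
  have h := Asymptotics.IsBigO.comp_tendsto PP_cong sq_tendsto
  have h2 : (fun t : ℂ ↦ (t ^ 2) ^ 5) =O[nhds 0] fun t ↦ t ^ 5 := by
    have hc : ContinuousAt (fun t : ℂ ↦ t ^ 5) 0 := by fun_prop
    have := (Asymptotics.isBigO_refl (fun t : ℂ ↦ t ^ 5) (nhds 0)).mul (hc.tendsto.isBigO_one ℂ)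
    simp only [mul_one] at this
    exact this.congr_left fun t ↦ by ring
  refine (h.trans h2).congr_left fun t ↦ ?_
  simp only [Function.comp]
  ring

/-- The function with `F = q² G(q⁴)`. -/
def GG (t : ℂ) : ℂ := PP (t ^ 2) ^ 8 / PP t ^ 4

lemma GG_diff : DifferentiableOn ℂ GG (Metric.ball 0 1) := by
  have h2 : DifferentiableOn ℂ (fun t : ℂ ↦ PP (t ^ 2)) (Metric.ball 0 1) := by
    refine PP_diff.comp (t := Metric.ball 0 1) (by fun_prop) fun t ht ↦ ?_
    have : ‖t‖ < 1 := by simpa using ht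
    simp only [Metric.mem_ball, dist_zero_right, norm_pow]
    exact pow_lt_one₀ (norm_nonneg _) this two_ne_zero
  exact (h2.pow 8).div (PP_diff.pow 4) fun t ht ↦ pow_ne_zero _ (PP_ne (by simpa using ht))

lemma GG_cong : Cong GG (fun t ↦ 1 + 4 * t + 6 * t ^ 2 + 8 * t ^ 3 + 13 * t ^ 4) := by
  have hc : ContinuousAt (fun t : ℂ ↦ 1 + 4 * t + 6 * t ^ 2 + 8 * t ^ 3 + 13 * t ^ 4) 0 := by
    fun_prop
  have h1 := ((PP2_cong.pow PP2_cont (by fun_prop) 8).trans poly_cong).trans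
    ((Cong.refl (fun t : ℂ ↦ 1 + 4 * t + 6 * t ^ 2 + 8 * t ^ 3 + 13 * t ^ 4)).mul
      (PP_cong.symm.pow (by fun_prop) PP_cont 4) (by fun_prop) hc)
  have hi : ContinuousAt (fun t ↦ (PP t ^ 4)⁻¹) 0 :=
    (PP_cont.pow 4).inv₀ (by simp [PP_zero])
  have h2 := Asymptotics.IsBigO.mul h1 (hi.tendsto.isBigO_one ℂ)
  simp only [mul_one] at h2
  refine h2.congr' ?_ .rfl
  filter_upwards [Metric.ball_mem_nhds (0 : ℂ) one_pos] with t ht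
  have := PP_ne (t := t) (by simpa using ht)
  simp only [GG]
  field_simp

lemma coeff_zero (n : ℕ) (d : ℕ → ℂ)
    (h : (fun t : ℂ ↦ ∑ k ∈ Finset.range n, d k * t ^ k) =O[nhdsWithin 0 {0}ᶜ] fun t ↦ t ^ n) :
    ∀ k < n, d k = 0 := by
  induction n generalizing d with
  | zero => simp
  | succ n ih =>
    have h0 : d 0 = 0 := by
      have t1 : Tendsto (fun t : ℂ ↦ ∑ k ∈ Finset.range (n + 1), d k * t ^ k)
          (nhdsWithin 0 {0}ᶜ) (nhds (d 0)) := by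
        have : Continuous (fun t : ℂ ↦ ∑ k ∈ Finset.range (n + 1), d k * t ^ k) := by fun_prop
        have := this.tendsto 0
        simp only [Finset.sum_range_succ'] at this ⊢
        simpa using this.mono_left nhdsWithin_le_nhds
      have t2 : Tendsto (fun t : ℂ ↦ t ^ (n + 1)) (nhdsWithin 0 {0}ᶜ) (nhds 0) := by
        have : Continuous (fun t : ℂ ↦ t ^ (n + 1)) := by fun_prop
        have := this.tendsto 0
        simpa using this.mono_left nhdsWithin_le_nhds
      exact tendsto_nhds_unique t1 (h.trans_tendsto t2)
    have h1 : (fun t : ℂ ↦ ∑ k ∈ Finset.range n, d (k + 1) * t ^ k) =O[nhdsWithin 0 {0}ᶜ]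
        fun t ↦ t ^ n := by
      have := h.mul (Asymptotics.isBigO_refl (fun t : ℂ ↦ t⁻¹) _)
      refine this.congr' ?_ ?_
      · filter_upwards [self_mem_nhdsWithin] with t ht
        have ht : t ≠ 0 := ht
        rw [Finset.sum_range_succ', h0, zero_mul, add_zero, Finset.sum_mul]
        refine Finset.sum_congr rfl fun k _ ↦ ?_
        field_simp
        ring
      · filter_upwards [self_mem_nhdsWithin] with t ht
        have ht : t ≠ 0 := ht
        field_simp
        ring
    intro k hk
    rcases k with _ | k
    · exact h0
    · exact ih (fun k ↦ d (k + 1)) h1 k (by omega)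

/-- Taylor coefficients -/
def cf (n : ℕ) : ℂ := iteratedDeriv n GG 0 / n.factorial

lemma cf_sum {t : ℂ} (ht : ‖t‖ < 1) : HasSum (fun n ↦ cf n * t ^ n) (GG t) := by
  have := Complex.hasSum_taylorSeries_on_ball GG_diff (z := t) (by simpa using ht)
  refine this.congr_fun fun n ↦ ?_
  simp only [cf, smul_eq_mul, sub_zero]
  ring

lemma cf_vals : ∀ k < 5, cf k = (![1, 4, 6, 8, 13] : Fin 5 → ℂ) (Fin.ofNat 5 k) := by
  have han : AnalyticAt ℂ GG 0 := GG_diff.analyticAt (Metric.ball_mem_nhds _ one_pos)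
  have h := han.hasFPowerSeriesAt.isBigO_sub_partialSum_pow 5
  have h' : (fun t : ℂ ↦ GG t - ∑ k ∈ Finset.range 5, cf k * t ^ k) =O[nhds 0] fun t ↦ t ^ 5 := by
    rw [← Asymptotics.isBigO_norm_right]
    simp only [norm_pow]
    refine h.congr_left fun t ↦ ?_
    simp [FormalMultilinearSeries.partialSum, cf, mul_comm]
  have h2 := (Asymptotics.IsBigO.sub GG_cong h').mono (nhdsWithin_le_nhds (s := {0}ᶜ))
  have := coeff_zero 5 (fun k ↦ cf k - (![1, 4, 6, 8, 13] : Fin 5 → ℂ) (Fin.ofNat 5 k))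
    (h2.congr_left fun t ↦ by
      simp [Finset.sum_range_succ, Fin.ofNat]
      ring)
  intro k hk
  exact sub_eq_zero.mp (this k hk)

lemma FF_form (z : ℍ) : FF z = Complex.exp (2 * π * Complex.I * z) ^ 2 *
    GG (Complex.exp (2 * π * Complex.I * z) ^ 4) := by
  have := Phi_form (fun z ↦ 2 * z) (4 * (z : ℂ))
  simp only [FF, grid_eta_eq, GG]
  rw [show 8 * (z : ℂ) = 2 * (4 * z) by ring, this]
  simp only [← Complex.exp_nat_mul]
  rw [mul_div_assoc]
  push_cast
  rw [show 2 * π * Complex.I * (2 * (2 * (4 * (z : ℂ))) - 4 * z) / 6 =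
      2 * (2 * π * Complex.I * z) by ring,
    show 2 * π * Complex.I * (2 * (4 * (z : ℂ))) = 2 * (4 * (2 * π * Complex.I * z)) by ring,
    show 2 * π * Complex.I * (4 * (z : ℂ)) = 4 * (2 * π * Complex.I * z) by ring]

lemma FF_hasSum (z : ℍ) :
    HasSum (fun n : ℕ ↦ cf n * Complex.exp (2 * π * Complex.I * z) ^ (4 * n + 2)) (FF z) := by
  rw [FF_form]
  have hq : ‖Complex.exp (2 * π * Complex.I * z)‖ < 1 := UpperHalfPlane.norm_exp_two_pi_I_lt_one z
  have := (cf_sum (t := Complex.exp (2 * π * Complex.I * z) ^ 4) (by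
    rw [norm_pow]; exact pow_lt_one₀ (norm_nonneg _) hq four_ne_zero)).mul_left
    (Complex.exp (2 * π * Complex.I * z) ^ 2)
  refine this.congr_fun fun n ↦ ?_
  ring

def ex (n : ℕ) : ℤ := 4 * n + 2

lemma ex_inj : Function.Injective ex := fun a b h ↦ by simp only [ex] at h; omega

def aa : ℤ → ℂ := Function.extend ex cf 0

lemma aa_ex (n : ℕ) : aa (ex n) = cf n := ex_inj.extend_apply _ _ _

lemma aa_not {m : ℤ} (h : ¬ ∃ n, ex n = m) : aa m = 0 := Function.extend_apply' _ _ _ h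

lemma FF_exp : HasExpansion 1 FF aa := by
  intro z
  refine (HasSum.tsum_eq ?_).symm
  rw [← ex_inj.hasSum_iff]
  · refine (FF_hasSum z).congr_fun fun n ↦ ?_
    simp only [Function.comp, aa_ex]
    rw [← Complex.exp_nat_mul]
    congr 2
    simp [ex]
    ring
  · intro m hm
    rw [aa_not (by simpa using hm), zero_mul]

/-- `η(8z)⁸/η(4z)⁴` is a holomorphic modular form of weight 2 for `Γ₀(8)` vanishing to order
2 at `∞`, with `q`-expansion `q² + 4q⁶ + 6q¹⁰ + 8q¹⁴ + 13q¹⁸ + ⋯`; all exponents with nonzero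
coefficient are `≡ 2 mod 4`. -/
theorem statement_13 :
    ∃ F : ModularForm (Gamma0 8) 2,
      (∀ z : ℍ, F z = Grid.eta (8 * (z : ℂ)) ^ 8 / Grid.eta (4 * (z : ℂ)) ^ 4) ∧
      ∃ a : ℤ → ℂ, HasExpansion 1 ⇑F a ∧ (∀ n < (2 : ℤ), a n = 0) ∧
        a 2 = 1 ∧ a 6 = 4 ∧ a 10 = 6 ∧ a 14 = 8 ∧ a 18 = 13 ∧
        ∀ n : ℤ, a n ≠ 0 → n % 4 = 2 := by
  refine ⟨FM, fun z ↦ rfl, aa, FF_exp, fun n hn ↦ aa_not ?_, ?_, ?_, ?_, ?_, ?_, fun n hn ↦ ?_⟩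
  · rintro ⟨m, rfl⟩
    simp only [ex] at hn
    omega
  · exact (aa_ex 0).trans (cf_vals 0 (by norm_num))
  · exact (aa_ex 1).trans (cf_vals 1 (by norm_num))
  · exact (aa_ex 2).trans (cf_vals 2 (by norm_num))
  · exact (aa_ex 3).trans (cf_vals 3 (by norm_num))
  · exact (aa_ex 4).trans (cf_vals 4 (by norm_num))
  · by_contra h
    refine hn (aa_not ?_)
    rintro ⟨m, rfl⟩
    simp only [ex] at h
    omega
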